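/- (Wiener–Hopf factorization for the Kendall random walk.) Let α > 0, let ν be a symmetric probability measure on ℝ with ν({0}) = 0, let Ψ(s) = (1 − |s|^α)₊, let G(t) = ∫_ℝ Ψ(x/t) ν(dx) for t > 0, and let K(x,·) := δ̃_x ▵_α ν. For k ≥ 1 and u > 0 set I_k(u) := ∫_{(−∞,0]} ⋯ ∫_{(−∞,0]} [ ∫_{(0,∞)} Ψ(u y) K(x_{k−1}, dy) ] K(x_{k−2}, dx_{k−1}) ⋯ K(x₁, dx₂) ν(dx₁), with I₁(u) := ∫_{(0,∞)} Ψ(u y) ν(dy). Then for all 0 ≤ s ≤ 1 and u > 0, Σ_{k=1}^∞ s^k I_k(u) = ( (s/2) G(1/u) ) / ( 1 − (s/2) G(1/u) ) = [ (s/2)/(1 − s/2) ] · [ (1 − s/2) G(1/u) / (1 − (s/2) G(1/u)) ]. Equivalently, E[ s^{τ₀⁺} Ψ(u X_{τ₀⁺}) ] = E[ s^{τ₀⁺} ] · E[ Ψ(u Z_{s/2}) ], where τ₀⁺ is the first hitting time of (0,∞) by the Kendall random walk started at 0, X_{τ₀⁺} the position at that time, E s^{τ₀⁺} = (s/2)/(1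 − s/2), and Z_{s/2} is a geometric-Kendall random variable with E Ψ(u Z_{s/2}) = (1 − s/2)G(1/u)/(1 − (s/2)G(1/u)). -/

import Mathlib

open MeasureTheory

/-- `Ψ(t) = (1 - |t|^α)₊`. -/
noncomputable def Psi (α t : ℝ) : ℝ := max (1 - |t| ^ α) 0

/-- The Williamson transform of a measure on `ℝ`. -/
noncomputable def williamson (α : ℝ) (ν : Measure ℝ) (t : ℝ) : ℝ :=
  ∫ x, Psi α (x * t) ∂ν

/-- A measure on `ℝ` is symmetric if it is invariant under `x ↦ -x`. -/
def IsSymmetric (ν : Measure ℝ) : Prop := ν.map (fun x => -x) = ν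

/-- The rescaling operator `T_a`: `(T_a λ)(A) = λ(A / a)` for `a ≠ 0`, `T_0 λ = δ_0`. -/
noncomputable def rescale (a : ℝ) (μ : Measure ℝ) : Measure ℝ :=
  if a = 0 then Measure.dirac 0 else μ.map (fun x => a * x)

/-- `δ̃_x = (δ_x + δ_{-x})/2`. -/
noncomputable def deltaTilde (x : ℝ) : Measure ℝ :=
  (2 : ENNReal)⁻¹ • (Measure.dirac x + Measure.dirac (-x))

/-- The symmetric Pareto measure `π̃_{2α}` with density `α |y|^{-2α-1} 1_{|y| ≥ 1}`. -/
noncomputable def pareto (α : ℝ) : Measure ℝ :=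
  volume.withDensity fun y =>
    ENNReal.ofReal (if 1 ≤ |y| then α * |y| ^ (-2 * α - 1) else 0)

/-- Kendall convolution of two symmetric two-point masses:
`δ̃_x ▵_α δ̃_y = T_M (ϱ^α π̃_{2α} + (1 - ϱ^α) δ̃_1)`. -/
noncomputable def kendallPoint (α x y : ℝ) : Measure ℝ :=
  let M := max |x| |y|
  let m := min |x| |y|
  let ρ := if M = 0 then 0 else m / M
  rescale M (ENNReal.ofReal (ρ ^ α) • pareto α +
    ENNReal.ofReal (1 - ρ ^ α) • deltaTilde 1)

/-- Kendall convolution of two measures on `ℝ`: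
`(ν₁ ▵_α ν₂)(A) = ∫∫ (δ̃_x ▵_α δ̃_y)(A) ν₁(dx) ν₂(dy)`. -/
noncomputable def kendall (α : ℝ) (ν₁ ν₂ : Measure ℝ) : Measure ℝ :=
  ν₁.bind fun x => ν₂.bind fun y => kendallPoint α x y

/-- `n`-fold Kendall convolution power `ν^{▵_α n}`. -/
noncomputable def kendallPow (α : ℝ) (ν : Measure ℝ) : ℕ → Measure ℝ
  | 0 => Measure.dirac 0
  | 1 => ν
  | n + 2 => kendall α (kendallPow α ν (n + 1)) ν

/-- The one-step kernel of the Kendall random walk: `K(x, ·) = δ̃_x ▵_α ν`. -/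
noncomputable def kendallKernel (α : ℝ) (ν : Measure ℝ) (x : ℝ) : Measure ℝ :=
  ν.bind fun y => kendallPoint α x y

/-- `excursion α ν n` is the sub-probability distribution of `X_{n+1}` on the event
`X₁ ≤ 0, …, X_n ≤ 0` for the Kendall random walk started at `0`, so that
`Φ_{n+1}(t) = excursion α ν n ((0,t))`. -/
noncomputable def excursion (α : ℝ) (ν : Measure ℝ) : ℕ → Measure ℝ
  | 0 => ν
  | n + 1 => ((excursion α ν n).restrict (Set.Iic 0)).bind (kendallKernel α ν)

/-- The test function `1_A(z) Ψ(uz)`, as an extended nonnegative real. -/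
noncomputable def whTest (α u : ℝ) (A : Set ℝ) : ℝ → ENNReal :=
  A.indicator fun z => ENNReal.ofReal (Psi α (u * z))

lemma measurable_Psi (α : ℝ) : Measurable (Psi α) := by
  unfold Psi
  fun_prop

lemma Psi_nonneg (α t : ℝ) : 0 ≤ Psi α t := le_max_right _ _

lemma Psi_le_one (α t : ℝ) : Psi α t ≤ 1 := by
  unfold Psi
  have : 0 ≤ |t| ^ α := by positivity
  exact max_le (by linarith) zero_le_one

lemma measurable_whTest (α u : ℝ) {A : Set ℝ} (hA : MeasurableSet A) :
    Measurable (whTest α u A) := by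
  unfold whTest
  refine Measurable.indicator ?_ hA
  have := measurable_Psi α
  fun_prop

lemma whTest_scale_Ioi (α u M z : ℝ) (hM : 0 < M) :
    whTest α u (Set.Ioi 0) (M * z) = whTest α (u * M) (Set.Ioi 0) z := by
  simp [whTest, Set.indicator_apply, hM, mul_assoc]

lemma whTest_scale_Iic (α u M z : ℝ) (hM : 0 < M) :
    whTest α u (Set.Iic 0) (M * z) = whTest α (u * M) (Set.Iic 0) z := by
  have : M * z ≤ 0 ↔ z ≤ 0 := by
    constructor
    · intro h
      by_contra! h'
      have := mul_pos hM h'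
      linarith
    · intro h
      exact mul_nonpos_of_nonneg_of_nonpos hM.le h
  simp [whTest, Set.indicator_apply, this, mul_assoc]

lemma measurable_paretoDensity (α : ℝ) : Measurable fun y : ℝ =>
    ENNReal.ofReal (if 1 ≤ |y| then α * |y| ^ (-2 * α - 1) else 0) := by
  refine ENNReal.measurable_ofReal.comp ?_
  refine Measurable.ite ?_ (by fun_prop) measurable_const
  exact measurableSet_le measurable_const (by fun_prop)

lemma Psi_of_one_le {α t : ℝ} (hα : 0 < α) (ht : 1 ≤ |t|) : Psi α t = 0 := by
  unfold Psi
  have := Real.one_le_rpow ht hα.le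
  exact max_eq_right (by linarith)

lemma Psi_of_le_one {α t : ℝ} (hα : 0 < α) (ht : |t| ≤ 1) : Psi α t = 1 - |t| ^ α := by
  unfold Psi
  have := Real.rpow_le_one (abs_nonneg t) ht hα.le
  exact max_eq_left (by linarith)

lemma pareto_interval (α c : ℝ) (hα : 0 < α) (hc : 0 < c) (hc1 : c < 1) :
    ∫ z in (1 : ℝ)..(1 / c), α * z ^ (-2 * α - 1) * (1 - c ^ α * z ^ α)
      = (1 - c ^ α) ^ 2 / 2 := by
  have h1c : 1 ≤ 1 / c := by
    rw [le_div_iff₀ hc]; linarith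
  have key := intervalIntegral.integral_eq_sub_of_hasDerivAt (a := 1) (b := 1 / c)
    (f := fun z : ℝ => - z ^ (-2 * α) / 2 + c ^ α * z ^ (-α))
    (f' := fun z : ℝ => α * z ^ (-2 * α - 1) * (1 - c ^ α * z ^ α)) ?_ ?_
  · rw [key]
    have e1 : (1 / c) ^ (-2 * α) = (c ^ α) ^ 2 := by
      rw [one_div, Real.inv_rpow hc.le, ← Real.rpow_neg hc.le, ← Real.rpow_natCast,
        ← Real.rpow_mul hc.le]
      congr 1; push_cast; ring
    have e2 : (1 / c) ^ (-α) = c ^ α := by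
      rw [one_div, Real.inv_rpow hc.le, ← Real.rpow_neg hc.le, neg_neg]
    simp only [e1, e2, Real.one_rpow]
    ring
  · intro z hz
    rw [Set.uIcc_of_le h1c] at hz
    have hz0 : 0 < z := by linarith [hz.1]
    have d1 := Real.hasDerivAt_rpow_const (x := z) (p := -2 * α) (Or.inl hz0.ne')
    have d2 := Real.hasDerivAt_rpow_const (x := z) (p := -α) (Or.inl hz0.ne')
    refine ((d1.neg.div_const 2).add (d2.const_mul (c ^ α))).congr_deriv ?_
    have : z ^ (-α - 1) = z ^ (-2 * α - 1) * z ^ α := by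
      rw [← Real.rpow_add hz0]; congr 1; ring
    rw [this]; ring
  · apply ContinuousOn.intervalIntegrable
    rw [Set.uIcc_of_le h1c]
    intro z hz
    have hz0 : z ≠ 0 := by linarith [hz.1]
    apply ContinuousAt.continuousWithinAt
    have c1 := Real.continuousAt_rpow_const z (-2 * α - 1) (Or.inl hz0)
    have c2 := Real.continuousAt_rpow_const z α (Or.inl hz0)
    exact (continuousAt_const.mul c1).mul (continuousAt_const.sub (continuousAt_const.mul c2))

lemma pareto_Ioi (α c : ℝ) (hα : 0 < α) (hc : 0 < c) :
    ∫⁻ z, whTest α c (Set.Ioi 0) z ∂(pareto α) = ENNReal.ofReal (Psi α c ^ 2 / 2) := by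
  unfold pareto
  rw [lintegral_withDensity_eq_lintegral_mul _ (measurable_paretoDensity α)
    (measurable_whTest α c measurableSet_Ioi)]
  rcases le_or_gt 1 c with h1 | h1
  · rw [Psi_of_one_le hα (by rwa [abs_of_pos hc])]
    simp only [ne_eq, OfNat.ofNat_ne_zero, not_false_eq_true, zero_pow, zero_div,
      ENNReal.ofReal_zero]
    rw [lintegral_eq_zero_of_ae_eq_zero]
    refine Filter.Eventually.of_forall fun z => ?_
    simp only [Pi.mul_apply, Pi.zero_apply, mul_eq_zero]
    by_cases hz : 1 ≤ |z|
    · right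
      have : Psi α (c * z) = 0 := by
        apply Psi_of_one_le hα
        rw [abs_mul, abs_of_pos hc]
        nlinarith
      simp [whTest, Set.indicator_apply, this]
    · left; simp [hz]
  · have h1c : 1 ≤ 1 / c := by
      rw [le_div_iff₀ hc]; linarith
    have hcont : ContinuousOn (fun z : ℝ => α * z ^ (-2 * α - 1) * (1 - c ^ α * z ^ α))
        (Set.Icc 1 (1 / c)) := by
      intro z hz
      have hz0 : z ≠ 0 := by linarith [hz.1]
      apply ContinuousAt.continuousWithinAt
      have c1 := Real.continuousAt_rpow_const z (-2 * α - 1) (Or.inl hz0)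
      have c2 := Real.continuousAt_rpow_const z α (Or.inl hz0)
      exact (continuousAt_const.mul c1).mul
        (continuousAt_const.sub (continuousAt_const.mul c2))
    rw [Psi_of_le_one hα (by rw [abs_of_pos hc]; exact h1.le), abs_of_pos hc,
      ← pareto_interval α c hα hc h1, intervalIntegral.integral_of_le h1c,
      ← integral_Icc_eq_integral_Ioc,
      ofReal_integral_eq_lintegral_ofReal hcont.integrableOn_Icc,
      ← lintegral_indicator measurableSet_Icc]
    · refine lintegral_congr fun z => ?_
      simp only [Pi.mul_apply, whTest, Set.indicator_apply, Set.mem_Ioi, Set.mem_Icc]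
      by_cases hz1 : 1 ≤ z
      · have hz0 : 0 < z := by linarith
        rw [abs_of_pos hz0, if_pos hz1, if_pos hz0]
        by_cases hz2 : z ≤ 1 / c
        · rw [if_pos ⟨hz1, hz2⟩, ← ENNReal.ofReal_mul (by positivity)]
          have : c * z ≤ 1 := by
            rw [le_div_iff₀ hc] at hz2; linarith
          rw [Psi_of_le_one hα (by rw [abs_of_pos (by positivity)]; exact this),
            abs_of_pos (by positivity), Real.mul_rpow hc.le hz0.le]
        · rw [if_neg (by tauto)]
          have : 1 ≤ c * z := by
            push Not at hz2
            rw [div_lt_iff₀ hc] at hz2; linarith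
          rw [Psi_of_one_le hα (by rw [abs_of_pos (by positivity)]; exact this)]
          simp
      · rw [if_neg (by tauto : ¬ (1 ≤ z ∧ z ≤ 1 / c))]
        by_cases hz0 : 0 < z
        · rw [abs_of_pos hz0, if_neg hz1]; simp
        · rw [if_neg hz0]; simp
    · rw [Filter.EventuallyLE, ae_restrict_iff' measurableSet_Icc]
      refine Filter.Eventually.of_forall fun z hz => ?_
      have hz0 : 0 < z := by linarith [hz.1]
      have : c * z ≤ 1 := by
        have := hz.2
        rw [le_div_iff₀ hc] at this; linarith
      have h3 := Real.rpow_le_one (by positivity) this hα.le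
      rw [Real.mul_rpow hc.le hz0.le] at h3
      have : 0 ≤ 1 - c ^ α * z ^ α := by linarith
      simp only [Pi.zero_apply]
      positivity

lemma pareto_Iic (α c : ℝ) (hα : 0 < α) (hc : 0 < c) :
    ∫⁻ z, whTest α c (Set.Iic 0) z ∂(pareto α) = ENNReal.ofReal (Psi α c ^ 2 / 2) := by
  rw [← pareto_Ioi α c hα hc]
  unfold pareto
  rw [lintegral_withDensity_eq_lintegral_mul _ (measurable_paretoDensity α)
    (measurable_whTest α c measurableSet_Ioi),
    lintegral_withDensity_eq_lintegral_mul _ (measurable_paretoDensity α)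
    (measurable_whTest α c measurableSet_Iic), ← lintegral_neg_eq_self]
  refine lintegral_congr fun z => ?_
  simp only [Pi.mul_apply, whTest, Set.indicator_apply, Set.mem_Ioi, Set.mem_Iic, abs_neg,
    Psi, mul_neg]
  rcases lt_trichotomy z 0 with h | h | h
  · rw [if_neg (by linarith : ¬ (-z ≤ 0)), if_neg (by linarith : ¬ (0 < z))]
  · subst h; norm_num
  · rw [if_pos (by linarith : (-z ≤ 0)), if_pos h]

lemma measurable_kendallPoint (α : ℝ) :
    Measurable fun p : ℝ × ℝ => kendallPoint α p.1 p.2 := by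
  refine Measure.measurable_of_measurable_coe _ fun s hs => ?_
  have hsf : SFinite (pareto α) := by unfold pareto; infer_instance
  have hsd : SFinite (deltaTilde 1) := by unfold deltaTilde; infer_instance
  have hM : Measurable fun p : ℝ × ℝ => max |p.1| |p.2| := by fun_prop
  have hρ : Measurable fun p : ℝ × ℝ =>
      if max |p.1| |p.2| = 0 then (0 : ℝ) else min |p.1| |p.2| / max |p.1| |p.2| := by
    refine Measurable.ite ?_ measurable_const (by fun_prop)
    exact measurableSet_eq_fun hM measurable_const
  have hset : MeasurableSet {q : ℝ × ℝ | q.1 * q.2 ∈ s} :=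
    (measurable_fst.mul measurable_snd) hs
  have hp : Measurable fun p : ℝ × ℝ =>
      pareto α ((fun x => max |p.1| |p.2| * x) ⁻¹' s) :=
    (measurable_measure_prodMk_left (ν := pareto α) hset).comp hM
  have hd : Measurable fun p : ℝ × ℝ =>
      deltaTilde 1 ((fun x => max |p.1| |p.2| * x) ⁻¹' s) :=
    (measurable_measure_prodMk_left (ν := deltaTilde 1) hset).comp hM
  have heq : (fun p : ℝ × ℝ => kendallPoint α p.1 p.2 s) = fun p : ℝ × ℝ =>
      if max |p.1| |p.2| = 0 then Measure.dirac (0 : ℝ) s else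
        ENNReal.ofReal ((if max |p.1| |p.2| = 0 then (0 : ℝ)
          else min |p.1| |p.2| / max |p.1| |p.2|) ^ α) *
          pareto α ((fun x => max |p.1| |p.2| * x) ⁻¹' s) +
        ENNReal.ofReal (1 - (if max |p.1| |p.2| = 0 then (0 : ℝ)
          else min |p.1| |p.2| / max |p.1| |p.2|) ^ α) *
          deltaTilde 1 ((fun x => max |p.1| |p.2| * x) ⁻¹' s) := by
    funext p
    simp only [kendallPoint, rescale]
    by_cases h : max |p.1| |p.2| = 0
    · simp only [if_pos h]
    · simp only [if_neg h]
      rw [Measure.map_apply (by fun_prop) hs]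
      simp
  rw [heq]
  refine Measurable.ite ?_ measurable_const ?_
  · exact measurableSet_eq_fun hM measurable_const
  · refine Measurable.add (Measurable.mul ?_ hp) (Measurable.mul ?_ hd)
    · exact ENNReal.measurable_ofReal.comp (hρ.pow_const α)
    · exact ENNReal.measurable_ofReal.comp (measurable_const.sub (hρ.pow_const α))

lemma Psi_abs (α t : ℝ) : Psi α |t| = Psi α t := by simp [Psi]

lemma kendall_algebra (α u M m : ℝ) (hα : 0 < α) (hu : 0 < u) (hM : 0 < M) (hm : 0 ≤ m)
    (hmM : m ≤ M) :
    (m / M) ^ α * (Psi α (u * M) ^ 2 / 2) + (1 - (m / M) ^ α) * (Psi α (u * M) / 2)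
      = Psi α (u * M) * Psi α (u * m) / 2 := by
  rcases le_or_gt 1 (u * M) with h | h
  · rw [Psi_of_one_le (t := u * M) hα (by rwa [abs_of_pos (by positivity)])]
    ring
  · have h' : u * m ≤ 1 := by nlinarith
    rw [Psi_of_le_one (t := u * M) hα (by rw [abs_of_pos (by positivity)]; exact h.le),
      Psi_of_le_one (t := u * m) hα (by rw [abs_of_nonneg (by positivity)]; exact h'),
      abs_of_pos (by positivity), abs_of_nonneg (by positivity), Real.mul_rpow hu.le hM.le,
      Real.mul_rpow hu.le hm, Real.div_rpow hm hM.le]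
    have : 0 < M ^ α := by positivity
    field_simp
    ring

lemma kendallPoint_test (α u x y : ℝ) (hα : 0 < α) (hu : 0 < u) (hy : y ≠ 0) (A : Set ℝ)
    (hA : A = Set.Ioi 0 ∨ A = Set.Iic 0) :
    ∫⁻ z, whTest α u A z ∂(kendallPoint α x y) =
      ENNReal.ofReal (Psi α (u * x) * Psi α (u * y) / 2) := by
  have hAm : MeasurableSet A := by
    rcases hA with rfl | rfl
    · exact measurableSet_Ioi
    · exact measurableSet_Iic
  have hM : 0 < max |x| |y| := lt_max_of_lt_right (abs_pos.2 hy)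
  have hm : 0 ≤ min |x| |y| := by positivity
  have hmM : min |x| |y| ≤ max |x| |y| := min_le_max
  have hprod : Psi α (u * max |x| |y|) * Psi α (u * min |x| |y|)
      = Psi α (u * x) * Psi α (u * y) := by
    have e : ∀ t, Psi α (u * |t|) = Psi α (u * t) := fun t => by
      rw [← Psi_abs α (u * t), abs_mul, abs_of_pos hu]
    rcases le_total |x| |y| with h | h
    · rw [max_eq_right h, min_eq_left h, e, e, mul_comm]
    · rw [max_eq_left h, min_eq_right h, e, e]
  rw [← hprod, ← kendall_algebra α u _ _ hα hu hM hm hmM]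
  simp only [kendallPoint, rescale, if_neg hM.ne']
  generalize max |x| |y| = M at *
  generalize min |x| |y| = m at *
  have hr0 : 0 ≤ (m / M) ^ α := by positivity
  have hr1 : (m / M) ^ α ≤ 1 :=
    Real.rpow_le_one (by positivity) (by rw [div_le_one hM]; exact hmM) hα.le
  rw [lintegral_map (measurable_whTest α u hAm) (by fun_prop), lintegral_add_measure,
    lintegral_smul_measure, lintegral_smul_measure]
  have h1 : ∫⁻ z, whTest α u A (M * z) ∂(pareto α) =
      ENNReal.ofReal (Psi α (u * M) ^ 2 / 2) := by
    rcases hA with rfl | rfl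
    · simp only [whTest_scale_Ioi α u M _ hM]
      exact pareto_Ioi α _ hα (by positivity)
    · simp only [whTest_scale_Iic α u M _ hM]
      exact pareto_Iic α _ hα (by positivity)
  have h2 : ∫⁻ z, whTest α u A (M * z) ∂(deltaTilde 1) =
      ENNReal.ofReal (Psi α (u * M) / 2) := by
    unfold deltaTilde
    have hneg : Psi α (-(u * M)) = Psi α (u * M) := by simp [Psi]
    rw [lintegral_smul_measure, lintegral_add_measure, lintegral_dirac, lintegral_dirac,
      div_eq_inv_mul, ENNReal.ofReal_mul (by norm_num), ENNReal.ofReal_inv_of_pos (by norm_num)]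
    rcases hA with rfl | rfl
    · simp [whTest, Set.indicator_apply, hM, hM.le]
    · simp [whTest, Set.indicator_apply, hM, hM.le, hneg]
  rw [h1, h2, ENNReal.ofReal_add, ENNReal.ofReal_mul hr0, ENNReal.ofReal_mul (by linarith)]
  · rfl
  · have := Psi_nonneg α (u * M); positivity
  · have := Psi_nonneg α (u * M)
    exact mul_nonneg (by linarith) (by positivity)

lemma measurable_kendallKernel (α : ℝ) (ν : Measure ℝ) [IsProbabilityMeasure ν] :
    Measurable (kendallKernel α ν) := by
  refine Measure.measurable_of_measurable_coe _ fun s hs => ?_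
  have hk := measurable_kendallPoint α
  have : (fun x => kendallKernel α ν x s) = fun x => ∫⁻ y, kendallPoint α x y s ∂ν := by
    funext x
    unfold kendallKernel
    exact Measure.bind_apply hs (hk.comp measurable_prodMk_left).aemeasurable
  rw [this]
  exact Measurable.lintegral_prod_right ((Measure.measurable_coe hs).comp hk)

lemma integrable_Psi (α u : ℝ) (ν : Measure ℝ) [IsProbabilityMeasure ν] :
    Integrable (fun y => Psi α (u * y)) ν := by
  have := measurable_Psi α
  refine Integrable.of_bound (C := 1)
    (this.comp (measurable_const_mul u)).aestronglyMeasurable ?_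
  refine Filter.Eventually.of_forall fun y => ?_
  rw [Real.norm_of_nonneg (Psi_nonneg _ _)]
  exact Psi_le_one _ _

lemma kendallKernel_test (α u x : ℝ) (hα : 0 < α) (hu : 0 < u) (ν : Measure ℝ)
    [IsProbabilityMeasure ν] (h0 : ν {0} = 0) (A : Set ℝ)
    (hA : A = Set.Ioi 0 ∨ A = Set.Iic 0) :
    ∫⁻ z, whTest α u A z ∂(kendallKernel α ν x) =
      ENNReal.ofReal ((∫ y, Psi α (u * y) ∂ν) / 2) * ENNReal.ofReal (Psi α (u * x)) := by
  have hAm : MeasurableSet A := by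
    rcases hA with rfl | rfl
    · exact measurableSet_Ioi
    · exact measurableSet_Iic
  unfold kendallKernel
  have hk : Measurable fun y => kendallPoint α x y :=
    (measurable_kendallPoint α).comp measurable_prodMk_left
  rw [Measure.lintegral_bind hk.aemeasurable
    (measurable_whTest α u hAm).aemeasurable]
  have hae : ∀ᵐ y ∂ν, y ≠ 0 := by
    rw [ae_iff]; simpa using h0
  have : ∫⁻ y, ∫⁻ z, whTest α u A z ∂(kendallPoint α x y) ∂ν =
      ∫⁻ y, ENNReal.ofReal (Psi α (u * x) / 2 * Psi α (u * y)) ∂ν := by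
    refine lintegral_congr_ae ?_
    filter_upwards [hae] with y hy
    rw [kendallPoint_test α u x y hα hu hy A hA]
    congr 1; ring
  rw [this, ← ofReal_integral_eq_lintegral_ofReal ((integrable_Psi α u ν).const_mul _),
    integral_const_mul, ← ENNReal.ofReal_mul]
  · congr 1; ring
  · exact div_nonneg (integral_nonneg fun y => Psi_nonneg _ _) (by norm_num)
  · exact Filter.Eventually.of_forall fun y =>
      mul_nonneg (div_nonneg (Psi_nonneg _ _) (by norm_num)) (Psi_nonneg _ _)

lemma base_test (α u : ℝ) (ν : Measure ℝ)
    [IsProbabilityMeasure ν] (hsym : IsSymmetric ν) (h0 : ν {0} = 0) (A : Set ℝ)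
    (hA : A = Set.Ioi 0 ∨ A = Set.Iic 0) :
    ∫⁻ z, whTest α u A z ∂ν = ENNReal.ofReal ((∫ y, Psi α (u * y) ∂ν) / 2) := by
  have hae : ∀ᵐ y ∂ν, y ≠ 0 := by
    rw [ae_iff]; simpa using h0
  have hflip : ∫⁻ z, whTest α u (Set.Iic 0) z ∂ν = ∫⁻ z, whTest α u (Set.Ioi 0) z ∂ν := by
    conv_lhs => rw [← hsym]
    rw [lintegral_map (measurable_whTest α u measurableSet_Iic) measurable_neg]
    refine lintegral_congr_ae ?_
    filter_upwards [hae] with z hz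
    simp only [whTest, Set.indicator_apply, Set.mem_Ioi, Set.mem_Iic, Psi, mul_neg, abs_neg]
    have : -z ≤ 0 ↔ 0 < z := by
      rw [neg_nonpos]
      exact ⟨fun h => lt_of_le_of_ne h hz.symm, le_of_lt⟩
    simp only [this]
  have hsum : ∫⁻ z, whTest α u (Set.Ioi 0) z ∂ν + ∫⁻ z, whTest α u (Set.Iic 0) z ∂ν =
      ENNReal.ofReal (∫ y, Psi α (u * y) ∂ν) := by
    rw [ofReal_integral_eq_lintegral_ofReal (integrable_Psi α u ν)
      (Filter.Eventually.of_forall fun y => Psi_nonneg _ _),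
      ← lintegral_add_left (measurable_whTest α u measurableSet_Ioi)]
    refine lintegral_congr fun z => ?_
    simp only [whTest, Set.indicator_apply, Set.mem_Ioi, Set.mem_Iic]
    by_cases h : 0 < z
    · simp [h, h.not_ge]
    · simp [h, not_lt.1 h]
  have hI : ∫⁻ z, whTest α u (Set.Ioi 0) z ∂ν =
      ENNReal.ofReal ((∫ y, Psi α (u * y) ∂ν) / 2) := by
    rw [hflip, ← two_mul] at hsum
    rw [div_eq_inv_mul, ENNReal.ofReal_mul (by norm_num), ENNReal.ofReal_inv_of_pos (by norm_num),
      ← hsum, ← mul_assoc]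
    rw [show ENNReal.ofReal 2 = 2 by simp, ENNReal.inv_mul_cancel (by norm_num) (by norm_num),
      one_mul]
  rcases hA with rfl | rfl
  · exact hI
  · rw [hflip, hI]

lemma excursion_test (α u : ℝ) (hα : 0 < α) (hu : 0 < u) (ν : Measure ℝ)
    [IsProbabilityMeasure ν] (hsym : IsSymmetric ν) (h0 : ν {0} = 0) (n : ℕ) : ∀ (A : Set ℝ),
    (A = Set.Ioi 0 ∨ A = Set.Iic 0) →
    ∫⁻ z, whTest α u A z ∂(excursion α ν n) =
      ENNReal.ofReal ((∫ y, Psi α (u * y) ∂ν) / 2) ^ (n + 1) := by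
  induction n with
  | zero =>
    intro A hA
    rw [zero_add, pow_one]
    exact base_test α u ν hsym h0 A hA
  | succ n ih =>
    intro A hA
    have hAm : MeasurableSet A := by
      rcases hA with rfl | rfl
      · exact measurableSet_Ioi
      · exact measurableSet_Iic
    have hP := measurable_Psi α
    rw [excursion, Measure.lintegral_bind (measurable_kendallKernel α ν).aemeasurable
      (measurable_whTest α u hAm).aemeasurable]
    simp only [kendallKernel_test α u _ hα hu ν h0 A hA]
    rw [lintegral_const_mul _ (by fun_prop), ← lintegral_indicator measurableSet_Iic]
    change _ * ∫⁻ z, whTest α u (Set.Iic 0) z ∂(excursion α ν n) = _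
    rw [ih _ (Or.inr rfl), pow_succ' _ (n + 1)]

lemma excursion_integral (α u : ℝ) (hα : 0 < α) (hu : 0 < u) (ν : Measure ℝ)
    [IsProbabilityMeasure ν] (hsym : IsSymmetric ν) (h0 : ν {0} = 0) (n : ℕ) :
    ∫ y in Set.Ioi (0 : ℝ), Psi α (u * y) ∂(excursion α ν n) =
      ((∫ y, Psi α (u * y) ∂ν) / 2) ^ (n + 1) := by
  have hP := measurable_Psi α
  rw [integral_eq_lintegral_of_nonneg_ae
    (Filter.Eventually.of_forall fun y => Psi_nonneg _ _)
    (hP.comp (measurable_const_mul u)).aestronglyMeasurable,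
    ← lintegral_indicator measurableSet_Ioi]
  change (∫⁻ z, whTest α u (Set.Ioi 0) z ∂(excursion α ν n)).toReal = _
  rw [excursion_test α u hα hu ν hsym h0 n _ (Or.inl rfl), ENNReal.toReal_pow,
    ENNReal.toReal_ofReal]
  exact div_nonneg (integral_nonneg fun y => Psi_nonneg _ _) (by norm_num)

/-- Wiener–Hopf factorization for the Kendall random walk:
`E[s^{τ₀⁺} Ψ(u X_{τ₀⁺})] = Σ_{k≥1} s^k I_k(u) = (s/2)G(1/u)/(1 - (s/2)G(1/u))`, which
factors as `E[s^{τ₀⁺}] ⋅ E[Ψ(u Z_{s/2})]`, where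
`I_{n+1}(u) = ∫_{(0,∞)} Ψ(uy) d(excursion α ν n)(y)`. -/
theorem wiener_hopf_kendall (α : ℝ) (hα : 0 < α)
    (ν : Measure ℝ) [IsProbabilityMeasure ν] (hsym : IsSymmetric ν) (h0 : ν {0} = 0)
    (G : ℝ → ℝ)
    (hG : ∀ t : ℝ, 0 < t → G t = ∫ x, Psi α (x / t) ∂ν)
    (s u : ℝ) (hs0 : 0 ≤ s) (hs1 : s ≤ 1) (hu : 0 < u) :
    (∑' n : ℕ, s ^ (n + 1) * ∫ y in Set.Ioi (0 : ℝ), Psi α (u * y) ∂(excursion α ν n)) =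
      (s / 2 * G (1 / u)) / (1 - s / 2 * G (1 / u)) ∧
    (s / 2 * G (1 / u)) / (1 - s / 2 * G (1 / u)) =
      ((s / 2) / (1 - s / 2)) *
        ((1 - s / 2) * G (1 / u) / (1 - s / 2 * G (1 / u))) := by
  have hGu : G (1 / u) = ∫ y, Psi α (u * y) ∂ν := by
    rw [hG _ (by positivity)]
    congr 1; funext x; congr 1; field_simp
  have hG0 : 0 ≤ G (1 / u) := by
    rw [hGu]; exact integral_nonneg fun y => Psi_nonneg _ _
  have hG1 : G (1 / u) ≤ 1 := by
    rw [hGu]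
    calc _ ≤ ∫ _y, (1 : ℝ) ∂ν :=
          integral_mono (integrable_Psi α u ν) (integrable_const _) fun y => Psi_le_one _ _
      _ = 1 := by simp
  have hq0 : 0 ≤ s / 2 * G (1 / u) := by positivity
  have hq1 : s / 2 * G (1 / u) < 1 := by nlinarith
  constructor
  · have : ∀ n : ℕ, s ^ (n + 1) * ∫ y in Set.Ioi (0 : ℝ), Psi α (u * y) ∂(excursion α ν n) =
        (s / 2 * G (1 / u)) * (s / 2 * G (1 / u)) ^ n := fun n => by
      rw [excursion_integral α u hα hu ν hsym h0 n, ← hGu, ← mul_pow, ← pow_succ']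
      congr 1; ring
    simp only [this]
    rw [tsum_mul_left, tsum_geometric_of_lt_one hq0 hq1, ← div_eq_mul_inv]
  · have h1 : 1 - s / 2 ≠ 0 := by linarith
    have h2 : 1 - s / 2 * G (1 / u) ≠ 0 := by linarith
    generalize G (1 / u) = g at *
    rw [div_mul_div_comm, div_eq_div_iff h2 (mul_ne_zero h1 h2)]
    ring
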